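/- Let P₀ = {2m/3 : m ∈ ℕ} ⊆ [0,∞). For every QTL formula φ (in the single atomic proposition p, evaluated under the valuation P₀) there exists t₀ ≥ 0 such that the truth set of φ beyond t₀ is trivial: the set {t ∈ [0,∞) : t > t₀ and φ holds at t} equals one of the four sets {t > t₀ : t ∈ P₀}, {t > t₀ : t ∉ P₀}, {t : t > t₀}, and ∅. -/

import Mathlib

/-- Syntax of QTL formulas over a single atomic proposition `p`. -/
inductive QTL : Type
  | top : QTL
  | atom : QTL
  | not : QTL → QTL
  | and : QTL → QTL → QTL
  | until_ : QTL → QTL → QTL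
  | since : QTL → QTL → QTL
  | diam : QTL → QTL
  | diamBar : QTL → QTL

/-- Satisfaction of QTL formulas over the time domain `[0,∞)`, with valuation `P` for `p`. -/
def QTL.Sat (P : Set ℝ) : QTL → ℝ → Prop
  | .top, _ => True
  | .atom, t => t ∈ P
  | .not φ, t => ¬ QTL.Sat P φ t
  | .and φ ψ, t => QTL.Sat P φ t ∧ QTL.Sat P ψ t
  | .until_ φ ψ, t => ∃ t₁, 0 ≤ t₁ ∧ t < t₁ ∧ QTL.Sat P ψ t₁ ∧
      ∀ s, 0 ≤ s → t < s → s < t₁ → QTL.Sat P φ s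
  | .since φ ψ, t => ∃ t₁, 0 ≤ t₁ ∧ t₁ < t ∧ QTL.Sat P ψ t₁ ∧
      ∀ s, 0 ≤ s → t₁ < s → s < t → QTL.Sat P φ s
  | .diam φ, t => ∃ s, 0 ≤ s ∧ t < s ∧ s < t + 1 ∧ QTL.Sat P φ s
  | .diamBar φ, t => ∃ s, 0 ≤ s ∧ s < t ∧ t < s + 1 ∧ QTL.Sat P φ s

/-- The valuation `P₀ = {2m/3 : m ∈ ℕ}`. -/
def P₀ : Set ℝ := {x : ℝ | ∃ m : ℕ, x = 2 * m / 3}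

lemma P₀_nonneg {t : ℝ} (h : t ∈ P₀) : 0 ≤ t := by
  obtain ⟨m, rfl⟩ := h
  positivity

lemma notMem_P₀_of_lt_of_lt {m : ℕ} {s : ℝ} (h₁ : 2 * (m : ℝ) / 3 < s)
    (h₂ : s < 2 * ((m + 1 : ℕ) : ℝ) / 3) : s ∉ P₀ := by
  rintro ⟨k, rfl⟩
  have h₃ : (m : ℝ) < k := by linarith
  have h₄ : (k : ℝ) < (m + 1 : ℕ) := by linarith
  norm_cast at h₃ h₄
  omega

lemma exists_next_P₀ {t : ℝ} (ht : 0 ≤ t) :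
    ∃ r ∈ P₀, t < r ∧ r < t + 1 ∧ ∀ s, t < s → s < r → s ∉ P₀ := by
  have h₁ := Nat.floor_le (show 0 ≤ 3 * t / 2 by positivity)
  have h₂ := Nat.lt_floor_add_one (3 * t / 2)
  refine ⟨2 * ((⌊3 * t / 2⌋₊ + 1 : ℕ) : ℝ) / 3, ⟨_, rfl⟩, ?_, ?_, fun s hs hsr ↦
    notMem_P₀_of_lt_of_lt (by linarith) hsr⟩
  · push_cast; linarith
  · push_cast; linarith

lemma exists_prev_P₀ {t : ℝ} (ht : 0 < t) :
    ∃ r ∈ P₀, r < t ∧ t < r + 1 ∧ ∀ s, r < s → s < t → s ∉ P₀ := by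
  obtain ⟨n, hn⟩ :=
    Nat.exists_eq_succ_of_ne_zero (Nat.ceil_pos.2 (show 0 < 3 * t / 2 by positivity)).ne'
  have h₁ := Nat.le_ceil (3 * t / 2)
  have h₂ := Nat.ceil_lt_add_one (show 0 ≤ 3 * t / 2 by positivity)
  rw [hn, Nat.cast_succ] at h₁ h₂
  refine ⟨2 * (n : ℝ) / 3, ⟨_, rfl⟩, by linarith, by linarith, fun s hs hst ↦
    notMem_P₀_of_lt_of_lt hs ?_⟩
  push_cast; linarith

lemma exists_notMem_P₀_between {u v : ℝ} (hu : 0 ≤ u) (huv : u < v) :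
    ∃ s ∉ P₀, u < s ∧ s < v := by
  obtain ⟨r, -, hur, -, hr⟩ := exists_next_P₀ hu
  obtain ⟨s, hs, hs'⟩ := exists_between (lt_min hur huv)
  exact ⟨s, hr s hs (hs'.trans_le (min_le_left _ _)), hs, hs'.trans_le (min_le_right _ _)⟩

/-- Beyond `t₀`, the predicate `f` has constant truth value `a` on `P₀` and `b` off `P₀`. -/
def TrivialBeyond (t₀ : ℝ) (a b : Prop) (f : ℝ → Prop) : Prop :=
  ∀ t, t₀ < t → (t ∈ P₀ → (f t ↔ a)) ∧ (t ∉ P₀ → (f t ↔ b))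

namespace TrivialBeyond

variable {t₀ t₁ : ℝ} {a b c d : Prop} {f g : ℝ → Prop}

lemma mono (h : TrivialBeyond t₀ a b f) (h₀₁ : t₀ ≤ t₁) : TrivialBeyond t₁ a b f :=
  fun t ht ↦ h t (h₀₁.trans_lt ht)

lemma of_forall (h : ∀ t, t₀ < t → (f t ↔ a)) : TrivialBeyond t₀ a a f :=
  fun t ht ↦ ⟨fun _ ↦ h t ht, fun _ ↦ h t ht⟩

lemma or_of_apply (h : TrivialBeyond t₀ a b f) {t : ℝ} (ht : t₀ < t) (hf : f t) : a ∨ b := by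
  by_cases hP : t ∈ P₀
  · exact .inl (((h t ht).1 hP).1 hf)
  · exact .inr (((h t ht).2 hP).1 hf)

lemma until_ (hf : TrivialBeyond t₀ a b f) (hg : TrivialBeyond t₀ c d g) (h₀ : 0 ≤ t₀) :
    TrivialBeyond t₀ (b ∧ (c ∨ d)) (b ∧ (c ∨ d)) fun t ↦ ∃ t₁, 0 ≤ t₁ ∧ t < t₁ ∧ g t₁ ∧
      ∀ s, 0 ≤ s → t < s → s < t₁ → f s := by
  refine of_forall fun t ht ↦ ⟨?_, ?_⟩
  · rintro ⟨u, -, htu, hgu, hfu⟩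
    obtain ⟨s, hsP, hts, hsu⟩ := exists_notMem_P₀_between (h₀.trans ht.le) htu
    exact ⟨((hf s (ht.trans hts)).2 hsP).1 (hfu s (by linarith) hts hsu),
      hg.or_of_apply (ht.trans htu) hgu⟩
  · rintro ⟨hb, hcd⟩
    obtain ⟨r, hrP, htr, -, hr⟩ := exists_next_P₀ (h₀.trans ht.le)
    have key : ∀ s, t < s → s < r → f s := fun s hs hsr ↦
      ((hf s (ht.trans hs)).2 (hr s hs hsr)).2 hb
    rcases hcd with hc | hd
    · exact ⟨r, P₀_nonneg hrP, htr, ((hg r (ht.trans htr)).1 hrP).2 hc, fun s _ ↦ key s⟩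
    · obtain ⟨u, htu, hur⟩ := exists_between htr
      exact ⟨u, by linarith, htu, ((hg u (ht.trans htu)).2 (hr u htu hur)).2 hd,
        fun s _ hts hsu ↦ key s hts (hsu.trans hur)⟩

lemma since (hf : TrivialBeyond t₀ a b f) (hg : TrivialBeyond t₀ c d g) (h₀ : 0 ≤ t₀) :
    ∃ e : Prop, TrivialBeyond (t₀ + 1) e e fun t ↦ ∃ t₁, 0 ≤ t₁ ∧ t₁ < t ∧ g t₁ ∧
      ∀ s, 0 ≤ s → t₁ < s → s < t → f s := by
  by_cases hb : b
  swap
  · refine ⟨False, of_forall fun t ht ↦ iff_false_intro ?_⟩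
    rintro ⟨u, hu, hut, -, hfu⟩
    obtain ⟨s, hsP, hs, hst⟩ := exists_notMem_P₀_between (hu.trans (le_max_left u t₀))
      (max_lt hut (by linarith : t₀ < t))
    obtain ⟨hus, hs₀⟩ := max_lt_iff.1 hs
    exact hb (((hf s hs₀).2 hsP).1 (hfu s (by linarith) hus hst))
  by_cases hcd : c ∨ d
  · refine ⟨True, of_forall fun t ht ↦ iff_true_intro ?_⟩
    obtain ⟨r, hrP, hrt, htr, hr⟩ := exists_prev_P₀ (show 0 < t by linarith)
    have hr₀ : t₀ < r := by linarith
    have key : ∀ s, r < s → s < t → f s := fun s hs hst ↦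
      ((hf s (hr₀.trans hs)).2 (hr s hs hst)).2 hb
    rcases hcd with hc | hd
    · exact ⟨r, P₀_nonneg hrP, hrt, ((hg r hr₀).1 hrP).2 hc, fun s _ ↦ key s⟩
    · obtain ⟨u, hru, hut⟩ := exists_between hrt
      exact ⟨u, by linarith, hut, ((hg u (hr₀.trans hru)).2 (hr u hru hut)).2 hd,
        fun s _ hus hst ↦ key s (hru.trans hus) hst⟩
  have hle : ∀ u, g u → u ≤ t₀ := fun u hu ↦ not_lt.1 fun h ↦ hcd (hg.or_of_apply h hu)
  by_cases ha : a
  · refine ⟨∃ u, 0 ≤ u ∧ g u ∧ ∀ s, 0 ≤ s → u < s → s ≤ t₀ → f s,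
      of_forall fun t ht ↦ ⟨?_, ?_⟩⟩
    · rintro ⟨u, hu, -, hgu, hfu⟩
      exact ⟨u, hu, hgu, fun s hs hus hs₀ ↦ hfu s hs hus (by linarith)⟩
    · rintro ⟨u, hu, hgu, hfu⟩
      refine ⟨u, hu, by linarith [hle u hgu], hgu, fun s hs hus _ ↦ ?_⟩
      rcases le_or_gt s t₀ with hs₀ | hs₀
      · exact hfu s hs hus hs₀
      · by_cases hP : s ∈ P₀
        · exact ((hf s hs₀).1 hP).2 ha
        · exact ((hf s hs₀).2 hP).2 hb
  · refine ⟨False, of_forall fun t ht ↦ iff_false_intro ?_⟩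
    rintro ⟨u, hu, hut, hgu, hfu⟩
    obtain ⟨r, hrP, hrt, htr, -⟩ := exists_prev_P₀ (show 0 < t by linarith)
    have hr₀ : t₀ < r := by linarith
    exact ha (((hf r hr₀).1 hrP).1 (hfu r (P₀_nonneg hrP) ((hle u hgu).trans_lt hr₀) hrt))

lemma diam (hf : TrivialBeyond t₀ a b f) (h₀ : 0 ≤ t₀) :
    TrivialBeyond t₀ (a ∨ b) (a ∨ b) fun t ↦ ∃ s, 0 ≤ s ∧ t < s ∧ s < t + 1 ∧ f s := by
  refine of_forall fun t ht ↦ ⟨?_, ?_⟩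
  · rintro ⟨s, -, hts, -, hs⟩
    exact hf.or_of_apply (ht.trans hts) hs
  · rintro (ha | hb)
    · obtain ⟨r, hrP, htr, hrt, -⟩ := exists_next_P₀ (h₀.trans ht.le)
      exact ⟨r, P₀_nonneg hrP, htr, hrt, ((hf r (ht.trans htr)).1 hrP).2 ha⟩
    · obtain ⟨s, hsP, hts, hst⟩ := exists_notMem_P₀_between (h₀.trans ht.le) (lt_add_one t)
      exact ⟨s, by linarith, hts, hst, ((hf s (ht.trans hts)).2 hsP).2 hb⟩

lemma diamBar (hf : TrivialBeyond t₀ a b f) (h₀ : 0 ≤ t₀) :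
    TrivialBeyond (t₀ + 1) (a ∨ b) (a ∨ b) fun t ↦ ∃ s, 0 ≤ s ∧ s < t ∧ t < s + 1 ∧ f s := by
  refine of_forall fun t ht ↦ ⟨?_, ?_⟩
  · rintro ⟨s, -, -, hts, hs⟩
    exact hf.or_of_apply (by linarith) hs
  · rintro (ha | hb)
    · obtain ⟨r, hrP, hrt, htr, -⟩ := exists_prev_P₀ (show 0 < t by linarith)
      exact ⟨r, P₀_nonneg hrP, hrt, htr, ((hf r (by linarith)).1 hrP).2 ha⟩
    · obtain ⟨s, hsP, hts, hst⟩ :=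
        exists_notMem_P₀_between (show 0 ≤ t - 1 by linarith) (sub_one_lt t)
      exact ⟨s, by linarith, hst, by linarith, ((hf s (by linarith)).2 hsP).2 hb⟩

end TrivialBeyond

lemma QTL.exists_trivialBeyond (φ : QTL) :
    ∃ t₀ : ℝ, 0 ≤ t₀ ∧ ∃ a b : Prop, TrivialBeyond t₀ a b (QTL.Sat P₀ φ) := by
  induction φ with
  | top => exact ⟨0, le_rfl, True, True, .of_forall fun _ _ ↦ Iff.rfl⟩
  | atom => exact ⟨0, le_rfl, True, False, fun _ _ ↦ ⟨iff_true_intro, iff_false_intro⟩⟩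
  | not φ ih =>
    obtain ⟨t₀, h₀, a, b, h⟩ := ih
    exact ⟨t₀, h₀, ¬a, ¬b, fun t ht ↦
      ⟨fun hP ↦ not_congr ((h t ht).1 hP), fun hP ↦ not_congr ((h t ht).2 hP)⟩⟩
  | and φ ψ ihφ ihψ =>
    obtain ⟨t₀, h₀, a, b, hφ⟩ := ihφ
    obtain ⟨t₁, -, c, d, hψ⟩ := ihψ
    replace hφ := hφ.mono (le_max_left t₀ t₁)
    replace hψ := hψ.mono (le_max_right t₀ t₁)
    exact ⟨max t₀ t₁, le_max_of_le_left h₀, a ∧ c, b ∧ d, fun t ht ↦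
      ⟨fun hP ↦ and_congr ((hφ t ht).1 hP) ((hψ t ht).1 hP),
        fun hP ↦ and_congr ((hφ t ht).2 hP) ((hψ t ht).2 hP)⟩⟩
  | until_ φ ψ ihφ ihψ =>
    obtain ⟨t₀, h₀, a, b, hφ⟩ := ihφ
    obtain ⟨t₁, -, c, d, hψ⟩ := ihψ
    have h := le_max_of_le_left (c := t₁) h₀
    exact ⟨_, h, _, _, (hφ.mono (le_max_left t₀ t₁)).until_ (hψ.mono (le_max_right t₀ t₁)) h⟩
  | since φ ψ ihφ ihψ =>
    obtain ⟨t₀, h₀, a, b, hφ⟩ := ihφ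
    obtain ⟨t₁, -, c, d, hψ⟩ := ihψ
    have h := le_max_of_le_left (c := t₁) h₀
    obtain ⟨e, he⟩ := (hφ.mono (le_max_left t₀ t₁)).since (hψ.mono (le_max_right t₀ t₁)) h
    exact ⟨_, by linarith, e, e, he⟩
  | diam φ ih =>
    obtain ⟨t₀, h₀, a, b, h⟩ := ih
    exact ⟨t₀, h₀, _, _, h.diam h₀⟩
  | diamBar φ ih =>
    obtain ⟨t₀, h₀, a, b, h⟩ := ih
    exact ⟨t₀ + 1, by linarith, _, _, h.diamBar h₀⟩

/-- Every QTL formula, evaluated under the valuation `P₀`, is eventually equivalent to one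
of the four trivial predicates `P₀`, `¬P₀`, `True`, `False`. -/
theorem QTL_eventually_trivial_on_P₀ (φ : QTL) :
    ∃ t₀ : ℝ, 0 ≤ t₀ ∧
      ({t : ℝ | t₀ < t ∧ QTL.Sat P₀ φ t} = {t : ℝ | t₀ < t ∧ t ∈ P₀} ∨
       {t : ℝ | t₀ < t ∧ QTL.Sat P₀ φ t} = {t : ℝ | t₀ < t ∧ t ∉ P₀} ∨
       {t : ℝ | t₀ < t ∧ QTL.Sat P₀ φ t} = {t : ℝ | t₀ < t} ∨
       {t : ℝ | t₀ < t ∧ QTL.Sat P₀ φ t} = ∅) := by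
  obtain ⟨t₀, h₀, a, b, h⟩ := φ.exists_trivialBeyond
  have key : ∀ t, t₀ < t → (QTL.Sat P₀ φ t ↔ (t ∈ P₀ ∧ a) ∨ (t ∉ P₀ ∧ b)) := fun t ht ↦ by
    have := h t ht
    tauto
  refine ⟨t₀, h₀, ?_⟩
  by_cases ha : a <;> by_cases hb : b
  · refine .inr (.inr (.inl (Set.ext fun t ↦ ?_)))
    have := key t
    simp only [Set.mem_ofPred_eq]
    tauto
  · refine .inl (Set.ext fun t ↦ ?_)
    have := key t
    simp only [Set.mem_ofPred_eq]
    tauto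
  · refine .inr (.inl (Set.ext fun t ↦ ?_))
    have := key t
    simp only [Set.mem_ofPred_eq]
    tauto
  · refine .inr (.inr (.inr (Set.ext fun t ↦ ?_)))
    have := key t
    simp only [Set.mem_ofPred_eq, Set.mem_empty_iff_false]
    tauto
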